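/- Under the two-group random mixture model with 𝒳=(0,1), f0(x)=1 for 0<x<1, f1 strictly decreasing on (0,1), and W1 a continuous random variable, let f(0+)=lim_{x→0+} f(x). Then for any α∈(π0/f(0+), π0), the oracle Benjamini–Hochberg rule δ^n_BH(α) satisfies: mFDR(δ^n_BH(α)) → α, mFNR(δ^n_BH(α)) → mFNR*(α), FDP(δ^n_BH(α)) → α in probability, and FNP(δ^n_BH(α)) → mFNR*(α) in probability, as n→∞. -/

import Mathlib

open MeasureTheory ProbabilityTheory Filter

namespace TwoGroup

/-- The two-group random mixture model: a σ-finite base measure on the sample space `𝒳`,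
a null proportion `π0 ∈ (0,1)`, and null/non-null probability density functions `f0`, `f1`
with respect to the base measure. -/
structure Model (𝒳 : Type*) [MeasurableSpace 𝒳] where
  base : Measure 𝒳
  sigmaFinite : SigmaFinite base
  π0 : ℝ
  π0_mem : π0 ∈ Set.Ioo (0 : ℝ) 1
  f0 : 𝒳 → ℝ
  f1 : 𝒳 → ℝ
  f0_meas : Measurable f0
  f1_meas : Measurable f1
  f0_nonneg : ∀ x, 0 ≤ f0 x
  f1_nonneg : ∀ x, 0 ≤ f1 x
  f0_prob : IsProbabilityMeasure (base.withDensity fun x => ENNReal.ofReal (f0 x))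
  f1_prob : IsProbabilityMeasure (base.withDensity fun x => ENNReal.ofReal (f1 x))

namespace Model

variable {𝒳 : Type*} [MeasurableSpace 𝒳] (M : Model 𝒳)

/-- The non-null proportion `π1 = 1 - π0`. -/
noncomputable def π1 : ℝ := 1 - M.π0

/-- The marginal density `f = π0 f0 + π1 f1`. -/
noncomputable def f (x : 𝒳) : ℝ := M.π0 * M.f0 x + M.π1 * M.f1 x

/-- The local false discovery rate `Lfdr(x) = π0 f0(x) / f(x)`. -/
noncomputable def Lfdr (x : 𝒳) : ℝ := M.π0 * M.f0 x / M.f x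

/-- The joint law of a single pair `(θ, X)`; `true` encodes `θ = 1` (non-null). -/
noncomputable def joint : Measure (Bool × 𝒳) :=
  (ENNReal.ofReal M.π0) •
      ((Measure.dirac false).prod (M.base.withDensity fun x => ENNReal.ofReal (M.f0 x))) +
    (ENNReal.ofReal M.π1) •
      ((Measure.dirac true).prod (M.base.withDensity fun x => ENNReal.ofReal (M.f1 x)))

/-- The joint law of `((θ1, X1), …, (θn, Xn))`: i.i.d. copies of `(θ, X)`. -/
noncomputable def jointN (n : ℕ) : Measure (Fin n → Bool × 𝒳) :=
  Measure.pi fun _ => M.joint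

end Model

/-- Number of rejections `Σ_i δ_i`. -/
def nRej {n : ℕ} (d : Fin n → Bool) : ℝ := ∑ i, if d i then (1 : ℝ) else 0

/-- Number of false discoveries `Σ_i δ_i (1 - θ_i)`. -/
def nFD {n : ℕ} (θ d : Fin n → Bool) : ℝ :=
  ∑ i, (if d i then (1 : ℝ) else 0) * (if θ i then (0 : ℝ) else 1)

/-- Number of acceptances `Σ_i (1 - δ_i)`. -/
def nAcc {n : ℕ} (d : Fin n → Bool) : ℝ := ∑ i, if d i then (0 : ℝ) else 1

/-- Number of false non-discoveries `Σ_i (1 - δ_i) θ_i`. -/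
def nFN {n : ℕ} (θ d : Fin n → Bool) : ℝ :=
  ∑ i, (if d i then (0 : ℝ) else 1) * (if θ i then (1 : ℝ) else 0)

/-- False discovery proportion. -/
noncomputable def FDP {n : ℕ} (θ d : Fin n → Bool) : ℝ := nFD θ d / max 1 (nRej d)

/-- False non-discovery proportion. -/
noncomputable def FNP {n : ℕ} (θ d : Fin n → Bool) : ℝ := nFN θ d / max 1 (nAcc d)

/-- A decision rule is a Markov kernel from `𝒳^n` to `{0,1}^n`: a measurable family of
probability measures on `Fin n → Bool`. -/
def IsRule {𝒳 : Type*} [MeasurableSpace 𝒳] {n : ℕ}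
    (κ : (Fin n → 𝒳) → Measure (Fin n → Bool)) : Prop :=
  Measurable κ ∧ ∀ x, IsProbabilityMeasure (κ x)

namespace Model

variable {𝒳 : Type*} [MeasurableSpace 𝒳] (M : Model 𝒳)

/-- The false discovery rate `FDR = E[FDP]` of a (randomized) decision rule. -/
noncomputable def FDR (n : ℕ) (κ : (Fin n → 𝒳) → Measure (Fin n → Bool)) : ℝ :=
  ∫ ω, ∫ d, FDP (fun i => (ω i).1) d ∂(κ fun i => (ω i).2) ∂(M.jointN n)

/-- The false non-discovery rate `FNR = E[FNP]` of a (randomized) decision rule. -/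
noncomputable def FNR (n : ℕ) (κ : (Fin n → 𝒳) → Measure (Fin n → Bool)) : ℝ :=
  ∫ ω, ∫ d, FNP (fun i => (ω i).1) d ∂(κ fun i => (ω i).2) ∂(M.jointN n)

/-- The marginal FDR `mFDR = E[Σ δi (1-θi)] / E[Σ δi]` (with `0/0 = 0`). -/
noncomputable def mFDR (n : ℕ) (κ : (Fin n → 𝒳) → Measure (Fin n → Bool)) : ℝ :=
  (∫ ω, ∫ d, nFD (fun i => (ω i).1) d ∂(κ fun i => (ω i).2) ∂(M.jointN n)) /
    (∫ ω, ∫ d, nRej d ∂(κ fun i => (ω i).2) ∂(M.jointN n))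

/-- The marginal FNR `mFNR = E[Σ (1-δi) θi] / E[Σ (1-δi)]` (with `0/0 = 0`). -/
noncomputable def mFNR (n : ℕ) (κ : (Fin n → 𝒳) → Measure (Fin n → Bool)) : ℝ :=
  (∫ ω, ∫ d, nFN (fun i => (ω i).1) d ∂(κ fun i => (ω i).2) ∂(M.jointN n)) /
    (∫ ω, ∫ d, nAcc d ∂(κ fun i => (ω i).2) ∂(M.jointN n))

/-- `FNR*_n(α)`: the minimum FNR over decision rules controlling FDR at level `α`. -/
noncomputable def FNRstar (n : ℕ) (α : ℝ) : ℝ :=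
  sInf {r | ∃ κ : (Fin n → 𝒳) → Measure (Fin n → Bool),
    IsRule κ ∧ M.FDR n κ ≤ α ∧ r = M.FNR n κ}

/-- The minimum mFNR over decision rules for `n` hypotheses controlling mFDR at level `α`. -/
noncomputable def mFNRstarN (n : ℕ) (α : ℝ) : ℝ :=
  sInf {r | ∃ κ : (Fin n → 𝒳) → Measure (Fin n → Bool),
    IsRule κ ∧ M.mFDR n κ ≤ α ∧ r = M.mFNR n κ}

/-- `mFNR*(α)` (this quantity does not depend on the number of hypotheses; we take `n = 1`). -/
noncomputable def mFNRstar (α : ℝ) : ℝ := M.mFNRstarN 1 α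

/-- The marginal law of a single observation `X ∼ f`. -/
noncomputable def Pmix : Measure 𝒳 := M.base.withDensity fun x => ENNReal.ofReal (M.f x)

/-- The law of `W = Lfdr(X)`, `X ∼ f`. -/
noncomputable def νW : Measure ℝ := M.Pmix.map M.Lfdr

/-- `G(t) = P(W ≤ t)`. -/
noncomputable def G (t : ℝ) : ℝ := (M.νW (Set.Iic t)).toReal

/-- `Ḡ(t) = P(W < t)`. -/
noncomputable def Gbar (t : ℝ) : ℝ := (M.νW (Set.Iio t)).toReal

/-- The generalized inverse `G^{-1}(u) = inf{t : G(t) ≥ u}`. -/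
noncomputable def Ginv (u : ℝ) : ℝ := sInf {t | u ≤ M.G t}

/-- `P(W = t)`. -/
noncomputable def atom (t : ℝ) : ℝ := (M.νW {t}).toReal

/-- The randomization probability `p(u)`, satisfying
`Ḡ(G^{-1}(u)) + p(u) P(W = G^{-1}(u)) = u`. -/
noncomputable def pu (u : ℝ) : ℝ := (u - M.Gbar (M.Ginv u)) / M.atom (M.Ginv u)

/-- `a(u) = E[W | S_u = 1]` for `u ∈ (0,1]`, `a(0) = 0`, where `S_u` is the Bernoulli(u)
thresholding variable of `W` at `G^{-1}(u)` with randomization `p(u)` at the boundary. -/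
noncomputable def a (u : ℝ) : ℝ :=
  if u = 0 then 0
  else ((∫ w in Set.Iio (M.Ginv u), w ∂M.νW) + M.pu u * (M.Ginv u * M.atom (M.Ginv u))) / u

/-- `b(u) = E[1 - W | S_u = 0]` for `u ∈ [0,1)`, `b(1) = 0`. -/
noncomputable def b (u : ℝ) : ℝ :=
  if u = 1 then 0
  else ((∫ w in Set.Ioi (M.Ginv u), (1 - w) ∂M.νW)
      + (1 - M.pu u) * ((1 - M.Ginv u) * M.atom (M.Ginv u))) / (1 - u)

/-- `b*(α) = inf{b(u) : u ∈ [0,1], a(u) ≤ α}`. -/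
noncomputable def bstar (α : ℝ) : ℝ :=
  sInf {y | ∃ u ∈ Set.Icc (0 : ℝ) 1, M.a u ≤ α ∧ y = M.b u}

/-- `u*(α) = sup{u ∈ [0,1] : a(u) ≤ α}`. -/
noncomputable def ustar (α : ℝ) : ℝ :=
  sSup {u | u ∈ Set.Icc (0 : ℝ) 1 ∧ M.a u ≤ α}

/-- `b**(α) = inf{E[b(U)] : U a [0,1]-valued random variable with E[a(U)] ≤ α}`. -/
noncomputable def bstarstar (α : ℝ) : ℝ :=
  sInf {y | ∃ ρ : Measure ℝ, IsProbabilityMeasure ρ ∧ (∀ᵐ u ∂ρ, u ∈ Set.Icc (0 : ℝ) 1) ∧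
    (∫ u, M.a u ∂ρ) ≤ α ∧ y = ∫ u, M.b u ∂ρ}

end Model

/-- The Bernoulli(p) measure on `Bool`. -/
noncomputable def bern (p : ℝ) : Measure Bool :=
  (ENNReal.ofReal p) • Measure.dirac true + (ENNReal.ofReal (1 - p)) • Measure.dirac false

namespace Model

variable {𝒳 : Type*} [MeasurableSpace 𝒳] (M : Model 𝒳)

/-- The per-observation rejection probability of the Neyman–Pearson rule at level `α`:
reject if `Lfdr(x) < G^{-1}(u*(α))`, randomize with probability `p(u*(α))` at equality,
and accept otherwise. -/
noncomputable def qNP (α : ℝ) (x : 𝒳) : ℝ :=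
  if M.Lfdr x < M.Ginv (M.ustar α) then 1
  else if M.Lfdr x = M.Ginv (M.ustar α) then M.pu (M.ustar α)
  else 0

/-- The Neyman–Pearson rule `δ^n_NP(α)`, as a Markov kernel: independent randomized
likelihood-ratio tests applied to each observation. -/
noncomputable def NP (α : ℝ) (n : ℕ) : (Fin n → 𝒳) → Measure (Fin n → Bool) :=
  fun x => Measure.pi fun i => bern (M.qNP α (x i))

/-- The probability (over data and the randomization of the rule `κ`) that the decision vector
lies in the set `E θ` (which may depend on the true labels `θ`). -/
noncomputable def prob (n : ℕ) (κ : (Fin n → 𝒳) → Measure (Fin n → Bool))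
    (E : (Fin n → Bool) → Set (Fin n → Bool)) : ℝ :=
  (∫⁻ ω, κ (fun i => (ω i).2) (E fun i => (ω i).1) ∂(M.jointN n)).toReal

end Model

/-- `sortedVal n w i` is the `i`-th order statistic `w_(i)` (for `1 ≤ i ≤ n`) of
`w 0, …, w (n-1)`. -/
noncomputable def sortedVal (n : ℕ) (w : Fin n → ℝ) (i : ℕ) : ℝ :=
  ((Multiset.map w Finset.univ.val).sort (· ≤ ·)).getD (i - 1) 0

/-- `avgLow n w k = (1/k) Σ_{i=1}^k w_(i)` (equal to `0` when `k = 0`). -/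
noncomputable def avgLow (n : ℕ) (w : Fin n → ℝ) (k : ℕ) : ℝ :=
  (∑ i ∈ Finset.Icc 1 k, sortedVal n w i) / k

/-- `avgHigh n w k = (1/(n-k)) Σ_{i=k+1}^n (1 - w_(i))` (equal to `0` when `k = n`). -/
noncomputable def avgHigh (n : ℕ) (w : Fin n → ℝ) (k : ℕ) : ℝ :=
  (∑ i ∈ Finset.Icc (k + 1) n, (1 - sortedVal n w i)) / ((n : ℝ) - k)

/-- The greatest convex minorant on `[0,1]` of a function `h`, evaluated at `α`. -/
noncomputable def gcm (h : ℝ → ℝ) (α : ℝ) : ℝ :=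
  sSup {y | ∃ C : ℝ → ℝ, ConvexOn ℝ (Set.Icc 0 1) C ∧
    (∀ t ∈ Set.Icc (0 : ℝ) 1, C t ≤ h t) ∧ y = C α}

end TwoGroup

namespace TwoGroup

/-- `X_(i)` with the convention `X_(0) = 0`. -/
noncomputable def sortedVal0 (n : ℕ) (x : Fin n → ℝ) (i : ℕ) : ℝ :=
  if i = 0 then 0 else sortedVal n x i

namespace Model

variable (M : Model ℝ)

/-- The Benjamini–Hochberg cutoff index
`i* = max{i ∈ {0,…,n} : X_(i) ≤ iα/(n π0)}` (with `X_(0) = 0`). -/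
noncomputable def iStarBH (α : ℝ) (n : ℕ) (x : Fin n → ℝ) : ℕ :=
  sSup {i | i ≤ n ∧ sortedVal0 n x i ≤ i * α / (n * M.π0)}

/-- The (oracle) Benjamini–Hochberg rule `δ^n_BH(α) = (1{X_i ≤ X_(i*)})_i`, viewed as the
deterministic Markov kernel `x ↦ δ_{BH decision}`. -/
noncomputable def BH (α : ℝ) (n : ℕ) : (Fin n → ℝ) → Measure (Fin n → Bool) :=
  fun x => Measure.dirac fun i => decide (x i ≤ sortedVal0 n x (M.iStarBH α n x))

end Model

/-- The number of coordinates of `x` that are at most `t`. -/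
noncomputable def countLE {n : ℕ} (x : Fin n → ℝ) (t : ℝ) : ℕ :=
  (Finset.univ.filter fun j => x j ≤ t).card

lemma countLE_mono {n : ℕ} (x : Fin n → ℝ) : Monotone (countLE x) := fun _ _ hst =>
  Finset.card_le_card fun j hj => by
    simp only [Finset.mem_filter, Finset.mem_univ, true_and] at hj ⊢
    exact hj.trans hst

lemma countLE_le {n : ℕ} (x : Fin n → ℝ) (t : ℝ) : countLE x t ≤ n :=
  (Finset.card_filter_le _ _).trans (by simp)

lemma countLE_lt_countLE {n : ℕ} (x : Fin n → ℝ) {s t : ℝ} (hst : s ≤ t) (j : Fin n)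
    (hs : s < x j) (ht : x j ≤ t) : countLE x s < countLE x t := by
  refine Finset.card_lt_card ⟨fun i hi => ?_, fun h => ?_⟩
  · simp only [Finset.mem_filter, Finset.mem_univ, true_and] at hi ⊢
    exact hi.trans hst
  · have := h (by simpa using ht : j ∈ _)
    simp only [Finset.mem_filter, Finset.mem_univ, true_and] at this
    linarith

lemma getElem_le_iff_lt_countP (t : ℝ) (l : List ℝ) (hl : l.Pairwise (· ≤ ·)) (i : ℕ)
    (hi : i < l.length) : l[i] ≤ t ↔ i < l.countP (fun y => decide (y ≤ t)) := by
  induction l generalizing i with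
  | nil => simp at hi
  | cons a l ih =>
    rw [List.pairwise_cons] at hl
    rw [List.countP_cons]
    by_cases ha : a ≤ t
    · cases i with
      | zero => simp [ha]
      | succ i =>
        have := ih hl.2 i (by simpa using hi)
        simp [ha, this]
    · have h0 : l.countP (fun y => decide (y ≤ t)) = 0 := by
        rw [List.countP_eq_zero]
        intro b hb
        have := hl.1 b hb
        simp only [decide_eq_true_eq, not_le]
        exact (not_le.1 ha).trans_le this
      rw [h0]
      simp only [ha, decide_false, Bool.false_eq_true, if_false, add_zero, not_lt_zero, iff_false,
        not_le]
      cases i with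
      | zero => simpa using ha
      | succ i =>
        exact (not_le.1 ha).trans_le (hl.1 _ (by simp))

lemma sortedVal_le_iff {n : ℕ} (x : Fin n → ℝ) (t : ℝ) {i : ℕ} (hi : 1 ≤ i) (hin : i ≤ n) :
    sortedVal n x i ≤ t ↔ i ≤ countLE x t := by
  set l := (Multiset.map x Finset.univ.val).sort (· ≤ ·) with hl
  have hlen : l.length = n := by simp [hl]
  have hlt : i - 1 < l.length := by omega
  have hc : l.countP (fun y => decide (y ≤ t)) = countLE x t := by
    rw [← Multiset.coe_countP, hl, Multiset.sort_eq, Multiset.countP_map]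
    rfl
  have := getElem_le_iff_lt_countP t l (Multiset.pairwise_sort _ _) (i - 1) hlt
  unfold sortedVal
  rw [← hl, List.getD_eq_getElem _ _ hlt, this, hc]
  omega

namespace Model

variable (M : Model ℝ) (α : ℝ) {n : ℕ} (x : Fin n → ℝ)

/-- The threshold `i* α / (n π0)` on the scale of the observations. -/
noncomputable def bhThreshold : ℝ := M.iStarBH α n x * α / (n * M.π0)

/-- The decision vector of the Benjamini–Hochberg rule. -/
noncomputable def bhDecision : Fin n → Bool :=
  fun i => decide (x i ≤ sortedVal0 n x (M.iStarBH α n x))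

lemma sortedVal0_le_iff {i : ℕ} (hin : i ≤ n) :
    sortedVal0 n x i ≤ i * α / (n * M.π0) ↔ i ≤ countLE x (i * α / (n * M.π0)) := by
  rcases Nat.eq_zero_or_pos i with rfl | hi
  · simp [sortedVal0]
  · rw [sortedVal0, if_neg hi.ne', sortedVal_le_iff x _ hi hin]

lemma iStarBH_eq_sup : M.iStarBH α n x = (Finset.range (n + 1)).sup fun i =>
    if i ≤ countLE x (i * α / (n * M.π0)) then i else 0 := by
  refine IsGreatest.csSup_eq ⟨?_, ?_⟩
  · obtain ⟨i, hi, h⟩ := Finset.exists_mem_eq_sup (Finset.range (n + 1)) (by simp) fun i =>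
      if i ≤ countLE x (i * α / (n * M.π0)) then i else 0
    rw [h, Set.mem_ofPred_eq]
    rw [Finset.mem_range] at hi
    split_ifs with h1
    · exact ⟨by omega, (M.sortedVal0_le_iff α x (by omega)).2 h1⟩
    · exact ⟨by omega, by simp [sortedVal0]⟩
  · rintro i ⟨hi, h1⟩
    have h2 := (M.sortedVal0_le_iff α x hi).1 h1
    have := Finset.le_sup (s := Finset.range (n + 1)) (b := i)
      (f := fun i => if i ≤ countLE x (i * α / (n * M.π0)) then i else 0)
      (Finset.mem_range.2 (by omega))
    simpa only [if_pos h2] using this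

lemma iStarBH_mem : M.iStarBH α n x ≤ n ∧ sortedVal0 n x (M.iStarBH α n x) ≤ M.bhThreshold α x :=
  Nat.sSup_mem (s := {i | i ≤ n ∧ sortedVal0 n x i ≤ i * α / (n * M.π0)})
    ⟨0, by simp [sortedVal0]⟩ ⟨n, fun _ h => h.1⟩

lemma le_iStarBH {i : ℕ} (hin : i ≤ n) (h : i ≤ countLE x (i * α / (n * M.π0))) :
    i ≤ M.iStarBH α n x :=
  le_csSup (s := {i | i ≤ n ∧ sortedVal0 n x i ≤ i * α / (n * M.π0)}) ⟨n, fun _ h => h.1⟩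
    ⟨hin, (M.sortedVal0_le_iff α x hin).2 h⟩

variable {α}

lemma countLE_bhThreshold (hα : 0 ≤ α) :
    countLE x (M.bhThreshold α x) = M.iStarBH α n x := by
  have hm := M.iStarBH_mem α x
  refine le_antisymm ?_ ((M.sortedVal0_le_iff α x hm.1).1 hm.2)
  by_contra! hlt
  have h1 : M.iStarBH α n x + 1 ≤ M.iStarBH α n x := by
    refine M.le_iStarBH α x (hlt.trans_le (countLE_le x _)) (le_trans hlt (countLE_mono x ?_))
    have := M.π0_mem.1
    unfold bhThreshold
    gcongr
    linarith
  omega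

lemma bhDecision_eq (hα : 0 ≤ α) :
    M.bhDecision α x = fun i => decide (x i ≤ M.bhThreshold α x) := by
  have hm := M.iStarBH_mem α x
  funext i
  refine decide_eq_decide.2 ⟨fun h => h.trans hm.2, fun h => ?_⟩
  by_contra! hlt
  have h1 := countLE_lt_countLE x hm.2 i hlt h
  rw [M.countLE_bhThreshold x hα] at h1
  rcases Nat.eq_zero_or_pos (M.iStarBH α n x) with h0 | h0
  · omega
  · have := (sortedVal_le_iff x _ h0 hm.1).1 le_rfl
    rw [sortedVal0, if_neg h0.ne'] at h1
    omega

lemma le_bhThreshold (hα : 0 < α) (hn : 0 < n) {t : ℝ} (h : n * M.π0 * t ≤ countLE x t * α) :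
    t ≤ M.bhThreshold α x := by
  have hπ := M.π0_mem.1
  have hn' : (0 : ℝ) < n := by exact_mod_cast hn
  have ht : t ≤ countLE x t * α / (n * M.π0) := by
    rw [le_div_iff₀ (by positivity)]
    linarith
  refine ht.trans ?_
  have : countLE x t ≤ M.iStarBH α n x :=
    M.le_iStarBH α x (countLE_le x t) (countLE_mono x ht)
  unfold bhThreshold
  gcongr

lemma measurable_countLE (t : ℝ) : Measurable fun x : Fin n → ℝ => countLE x t := by
  unfold countLE
  simp only [Finset.card_filter]
  refine Finset.measurable_sum _ fun j _ => ?_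
  exact Measurable.ite (measurableSet_le (measurable_pi_apply j) measurable_const)
    measurable_const measurable_const

lemma measurable_iStarBH : Measurable fun x : Fin n → ℝ => M.iStarBH α n x := by
  simp only [iStarBH_eq_sup]
  simp_rw [← Finset.sup'_eq_sup Finset.nonempty_range_add_one]
  refine Finset.measurable_range_sup'' fun i _ => ?_
  exact Measurable.ite (measurableSet_le measurable_const (measurable_countLE _))
    measurable_const measurable_const

lemma measurable_bhDecision (hα : 0 ≤ α) :
    Measurable fun x : Fin n → ℝ => M.bhDecision α x := by
  simp only [M.bhDecision_eq _ hα]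
  refine measurable_pi_lambda _ fun i => ?_
  have hτ : Measurable fun x : Fin n → ℝ => M.bhThreshold α x := by
    unfold bhThreshold
    exact (((measurable_from_nat (f := fun k : ℕ => (k : ℝ))).comp
      M.measurable_iStarBH).mul_const α).div_const _
  exact measurable_to_bool (by
    simpa [Set.preimage] using measurableSet_le (measurable_pi_apply i) hτ)

end Model
namespace Model

section Sampling

variable {𝒳 : Type*} [MeasurableSpace 𝒳] (M : Model 𝒳)

/-- The law of an observation under the null. -/
noncomputable def P0 : Measure 𝒳 := M.base.withDensity fun x => ENNReal.ofReal (M.f0 x)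

/-- The law of an observation under the alternative. -/
noncomputable def P1 : Measure 𝒳 := M.base.withDensity fun x => ENNReal.ofReal (M.f1 x)

instance : IsProbabilityMeasure M.P0 := M.f0_prob

instance : IsProbabilityMeasure M.P1 := M.f1_prob

lemma π1_pos : 0 < M.π1 := sub_pos.2 M.π0_mem.2

lemma joint_eq : M.joint = ENNReal.ofReal M.π0 • M.P0.map (Prod.mk false) +
    ENNReal.ofReal M.π1 • M.P1.map (Prod.mk true) := by
  rw [← Measure.dirac_prod, ← Measure.dirac_prod]
  rfl

instance : IsProbabilityMeasure M.joint := by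
  have h0 : IsProbabilityMeasure (M.P0.map (Prod.mk false)) :=
    Measure.isProbabilityMeasure_map (by fun_prop)
  have h1 : IsProbabilityMeasure (M.P1.map (Prod.mk true)) :=
    Measure.isProbabilityMeasure_map (by fun_prop)
  refine ⟨?_⟩
  rw [joint_eq]
  simp only [Measure.coe_add, Measure.coe_smul, Pi.add_apply, Pi.smul_apply, measure_univ,
    smul_eq_mul, mul_one]
  rw [← ENNReal.ofReal_add M.π0_mem.1.le M.π1_pos.le]
  simp [π1]

instance (n : ℕ) : IsProbabilityMeasure (M.jointN n) := by
  unfold jointN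
  infer_instance

lemma integrable_of_bounded {Ω : Type*} [MeasurableSpace Ω] (μ : Measure Ω) [IsFiniteMeasure μ]
    {φ : Ω → ℝ} (hφ : Measurable φ) {C : ℝ} (hC : ∀ z, |φ z| ≤ C) : Integrable φ μ :=
  Integrable.of_bound hφ.aestronglyMeasurable C (Eventually.of_forall hC)

lemma integral_joint {φ : Bool × 𝒳 → ℝ} (hφ : Measurable φ) {C : ℝ} (hC : ∀ z, |φ z| ≤ C) :
    ∫ z, φ z ∂M.joint =
      M.π0 * ∫ x, φ (false, x) ∂M.P0 + M.π1 * ∫ x, φ (true, x) ∂M.P1 := by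
  rw [joint_eq, integral_add_measure
    ((integrable_of_bounded _ hφ hC).smul_measure ENNReal.ofReal_ne_top)
    ((integrable_of_bounded _ hφ hC).smul_measure ENNReal.ofReal_ne_top),
    integral_smul_measure, integral_smul_measure,
    integral_map (by fun_prop) hφ.aestronglyMeasurable,
    integral_map (by fun_prop) hφ.aestronglyMeasurable,
    ENNReal.toReal_ofReal M.π0_mem.1.le, ENNReal.toReal_ofReal M.π1_pos.le]
  rfl

/-- The law of an infinite sequence of i.i.d. pairs `(θ, X)`. -/
noncomputable def seqLaw : Measure (ℕ → Bool × 𝒳) := Measure.infinitePi fun _ => M.joint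

instance : IsProbabilityMeasure M.seqLaw := by
  unfold seqLaw
  infer_instance

/-- The first `n` terms of a sequence. -/
def initial {β : Type*} (n : ℕ) (ω : ℕ → β) : Fin n → β := fun i => ω i

lemma measurable_initial {β : Type*} [MeasurableSpace β] (n : ℕ) :
    Measurable (initial n : (ℕ → β) → Fin n → β) := by
  unfold initial
  fun_prop

lemma map_initial_seqLaw (n : ℕ) : M.seqLaw.map (initial n) = M.jointN n := by
  exact (Measure.map_infinitePi_infinitePi_of_inj (P := fun _ : ℕ => M.joint)
    (f := fun i : Fin n => (i : ℕ)) Fin.val_injective).trans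
    (Measure.infinitePi_eq_pi (ι := Fin n) fun _ => M.joint)

lemma ae_tendsto_average {φ : Bool × 𝒳 → ℝ} (hφ : Measurable φ) {C : ℝ}
    (hC : ∀ z, |φ z| ≤ C) :
    ∀ᵐ ω ∂M.seqLaw, Tendsto (fun n : ℕ => (∑ i, φ (initial n ω i)) / n) atTop
      (nhds (∫ z, φ z ∂M.joint)) := by
  have hmap (i : ℕ) : M.seqLaw.map (fun ω => ω i) = M.joint :=
    Measure.infinitePi_map_eval (fun _ => M.joint) i
  have hcomp (i : ℕ) : Measurable fun ω : ℕ → Bool × 𝒳 => φ (ω i) :=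
    hφ.comp (measurable_pi_apply i)
  have hind : iIndepFun (fun (i : ℕ) ω => φ (ω i)) M.seqLaw :=
    iIndepFun_infinitePi (fun _ => hφ)
  have hdist (i : ℕ) : M.seqLaw.map (fun ω => φ (ω i)) = M.joint.map φ := by
    rw [← hmap i, Measure.map_map hφ (by fun_prop)]
    rfl
  have h := strong_law_ae_real (μ := M.seqLaw) (fun i ω => φ (ω i))
    (integrable_of_bounded _ (hcomp 0) fun ω => hC _)
    (fun i j hij => hind.indepFun hij)
    (fun i => ⟨(hcomp i).aemeasurable, (hcomp 0).aemeasurable, by rw [hdist, hdist]⟩)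
  have hexp : ∫ ω, φ (ω 0) ∂M.seqLaw = ∫ z, φ z ∂M.joint := by
    rw [← hmap 0, integral_map (measurable_pi_apply 0).aemeasurable hφ.aestronglyMeasurable]
  rw [hexp] at h
  filter_upwards [h] with ω hω
  refine hω.congr fun n => ?_
  rw [← Fin.sum_univ_eq_sum_range (fun i => φ (ω i))]
  rfl

lemma tendsto_integral_jointN {h : (n : ℕ) → (Fin n → Bool × 𝒳) → ℝ}
    (hm : ∀ n, Measurable (h n)) (hb : ∀ n z, |h n z| ≤ n) {l : ℝ}
    (hl : ∀ᵐ ω ∂M.seqLaw, Tendsto (fun n => h n (initial n ω) / n) atTop (nhds l)) :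
    Tendsto (fun n => (∫ z, h n z ∂M.jointN n) / n) atTop (nhds l) := by
  have key : Tendsto (fun n => ∫ ω, h n (initial n ω) / n ∂M.seqLaw) atTop
      (nhds (∫ _, l ∂M.seqLaw)) := by
    refine tendsto_integral_of_dominated_convergence (fun _ => 1)
      (fun n => (((hm n).comp (measurable_initial n)).div_const _).aestronglyMeasurable)
      (integrable_const _) (fun n => Eventually.of_forall fun ω => ?_) hl
    rw [Real.norm_eq_abs, abs_div, Nat.abs_cast]
    exact div_le_one_of_le₀ (hb n _) (Nat.cast_nonneg n)
  simp only [integral_const, probReal_univ, one_smul] at key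
  refine key.congr fun n => ?_
  rw [integral_div, ← M.map_initial_seqLaw n,
    integral_map (measurable_initial n).aemeasurable (hm n).aestronglyMeasurable]

lemma tendsto_jointN_deviation {h : (n : ℕ) → (Fin n → Bool × 𝒳) → ℝ}
    (hm : ∀ n, Measurable (h n)) {l : ℝ}
    (hl : ∀ᵐ ω ∂M.seqLaw, Tendsto (fun n => h n (initial n ω)) atTop (nhds l))
    {ε : ℝ} (hε : 0 < ε) :
    Tendsto (fun n => (M.jointN n {z | ε < |h n z - l|}).toReal) atTop (nhds 0) := by
  have hmeas := tendstoInMeasure_of_tendsto_ae (μ := M.seqLaw)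
    (f := fun n ω => h n (initial n ω)) (g := fun _ => l)
    (fun n => ((hm n).comp (measurable_initial n)).aestronglyMeasurable) hl
  have h1 := (ENNReal.tendsto_toReal ENNReal.zero_ne_top).comp
    (tendstoInMeasure_iff_dist.1 hmeas ε hε)
  refine squeeze_zero (fun n => ENNReal.toReal_nonneg) (fun n => ?_) h1
  refine ENNReal.toReal_mono (measure_ne_top _ _) ?_
  have hS : MeasurableSet {z | ε < |h n z - l|} :=
    measurableSet_lt measurable_const (((hm n).sub_const l).abs)
  rw [← M.map_initial_seqLaw n, Measure.map_apply (measurable_initial n) hS]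
  refine measure_mono fun ω hω => ?_
  rw [Set.mem_preimage, Set.mem_ofPred_eq] at hω
  rw [Set.mem_ofPred_eq, Real.dist_eq]
  exact hω.le

end Sampling

end Model
/-- The indicator of `x ≤ t`. -/
noncomputable def leInd (t x : ℝ) : ℝ := if x ≤ t then 1 else 0

lemma measurable_leInd (t : ℝ) : Measurable (leInd t) :=
  Measurable.ite measurableSet_Iic measurable_const measurable_const

lemma leInd_mem (t x : ℝ) : leInd t x ∈ Set.Icc (0 : ℝ) 1 := by
  unfold leInd
  split_ifs <;> simp

lemma abs_le_one_of_mem_Icc {y : ℝ} (hy : y ∈ Set.Icc (0 : ℝ) 1) : |y| ≤ 1 :=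
  abs_le.2 ⟨by linarith [hy.1], hy.2⟩

lemma continuous_integral_leInd (P : Measure ℝ) [IsFiniteMeasure P] [NullSingletonClass P] :
    Continuous fun t => ∫ x, leInd t x ∂P := by
  refine continuous_iff_continuousAt.2 fun t => ?_
  refine continuousAt_of_dominated (bound := fun _ => 1)
    (Eventually.of_forall fun s => (measurable_leInd s).aestronglyMeasurable)
    (Eventually.of_forall fun s => Eventually.of_forall fun x =>
      abs_le_one_of_mem_Icc (leInd_mem s x)) (integrable_const _) ?_
  have : ∀ᵐ x ∂P, x ≠ t := by simp [ae_iff]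
  filter_upwards [this] with x hx
  rcases lt_or_gt_of_ne hx with h | h
  · refine (continuousAt_const (y := (1 : ℝ))).congr ?_
    filter_upwards [lt_mem_nhds h] with s hs
    simp [leInd, hs.le]
  · refine (continuousAt_const (y := (0 : ℝ))).congr ?_
    filter_upwards [gt_mem_nhds h] with s hs
    simp [leInd, not_le.2 hs]

/-- A function on `[0,1]` running from `0` to `1` that has at each interior point a supporting
line from above, with strictly decreasing slopes exceeding `k > 1` near `0`, crosses the line
`k t` exactly once in `(0,1)`. -/
lemma exists_crossing {F c : ℝ → ℝ} {k L : ℝ} (hF : Continuous F) (hF0 : F 0 = 0)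
    (hF1 : F 1 = 1) (hsup : ∀ s ∈ Set.Ioo (0 : ℝ) 1, ∀ t ∈ Set.Icc (0 : ℝ) 1,
      F t - F s ≤ c s * (t - s))
    (hc : StrictAntiOn c (Set.Ioo 0 1)) (hL : Tendsto c (nhdsWithin 0 (Set.Ioi 0)) (nhds L))
    (hkL : k < L) (hk : 1 < k) :
    ∃ s ∈ Set.Ioo (0 : ℝ) 1, F s = k * s ∧ c s < k ∧ (∀ t, 0 < t → t < s → k * t < F t) ∧
      (∀ t, s < t → t ≤ 1 → F t < k * t) := by
  have hstrict : ∀ s ∈ Set.Ioo (0 : ℝ) 1, s * c s < F s := by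
    intro s hs
    have hs2 : s / 2 ∈ Set.Ioo (0 : ℝ) 1 := ⟨by linarith [hs.1], by linarith [hs.1, hs.2]⟩
    have h1 := hsup (s / 2) hs2 0 (by simp)
    have h2 := hsup s hs (s / 2) ⟨hs2.1.le, hs2.2.le⟩
    have h3 := hc hs2 hs (by linarith [hs.1])
    nlinarith [hs.1]
  obtain ⟨r, hr, hcr⟩ : ∃ r ∈ Set.Ioo (0 : ℝ) 1, k < c r := by
    have h1 : ∀ᶠ x in nhdsWithin (0 : ℝ) (Set.Ioi 0), k < c x := hL.eventually (lt_mem_nhds hkL)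
    have h2 : ∀ᶠ x in nhdsWithin (0 : ℝ) (Set.Ioi 0), x ∈ Set.Ioo (0 : ℝ) 1 :=
      Ioo_mem_nhdsGT one_pos
    obtain ⟨r, h⟩ := (h2.and h1).exists
    exact ⟨r, h⟩
  have hr' : k * r < F r := by nlinarith [hstrict r hr, hr.1]
  obtain ⟨s, hs, hFs⟩ : (0 : ℝ) ∈ (fun t => F t - k * t) '' Set.Ioo r 1 := by
    refine intermediate_value_Ioo' hr.2.le (by fun_prop) ⟨?_, ?_⟩
    · simp only [hF1]; linarith
    · linarith
  have hs' : s ∈ Set.Ioo (0 : ℝ) 1 := ⟨hr.1.trans hs.1, hs.2⟩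
  have hFs' : F s = k * s := by simpa [sub_eq_zero] using hFs
  have hck : c s < k := by
    have := hstrict s hs'
    rw [hFs'] at this
    nlinarith [hs'.1]
  refine ⟨s, hs', hFs', hck, fun t ht0 hts => ?_, fun t hst ht1 => ?_⟩
  · by_contra! hle
    have ht : t ∈ Set.Ioo (0 : ℝ) 1 := ⟨ht0, hts.trans hs'.2⟩
    have h1 := hstrict t ht
    have h2 : c t < k := by nlinarith
    have h3 := hsup t ht s ⟨hs'.1.le, hs'.2.le⟩
    nlinarith
  · have := hsup s hs' t ⟨by linarith [hs'.1], ht1⟩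
    nlinarith

namespace Model

variable (M : Model ℝ)

/-- The null is uniform on `(0,1)`, and the alternative density is supported on `(0,1)` and
strictly decreasing there. -/
structure UniformNull : Prop where
  base : M.base = volume
  f0 : M.f0 = fun x => if 0 < x ∧ x < 1 then (1 : ℝ) else 0
  f1_support : ∀ x : ℝ, ¬(0 < x ∧ x < 1) → M.f1 x = 0
  f1_anti : StrictAntiOn M.f1 (Set.Ioo 0 1)

variable {M}

namespace UniformNull

variable (h : M.UniformNull)
include h

lemma P0_eq : M.P0 = volume.restrict (Set.Ioo 0 1) := by
  rw [← withDensity_indicator_one measurableSet_Ioo, P0, h.base, h.f0]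
  congr 1
  funext x
  by_cases hx : 0 < x ∧ x < 1 <;> simp [Set.indicator, hx]

lemma integrable_f1 : Integrable M.f1 := by
  refine ⟨M.f1_meas.aestronglyMeasurable, ?_⟩
  rw [hasFiniteIntegral_iff_ofReal (Eventually.of_forall M.f1_nonneg)]
  have : M.P1 Set.univ = 1 := measure_univ
  rw [P1, h.base, withDensity_apply _ MeasurableSet.univ, Measure.restrict_univ] at this
  rw [this]
  exact ENNReal.one_lt_top

lemma integral_P1 (q : ℝ → ℝ) : ∫ x, q x ∂M.P1 = ∫ x in Set.Ioo 0 1, M.f1 x * q x := by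
  rw [setIntegral_eq_integral_of_forall_compl_eq_zero, P1, h.base,
    integral_withDensity_eq_integral_toReal_smul M.f1_meas.ennreal_ofReal
      (Eventually.of_forall fun _ => ENNReal.ofReal_lt_top)]
  · simp [ENNReal.toReal_ofReal (M.f1_nonneg _)]
  · intro x hx
    rw [h.f1_support x hx, zero_mul]

lemma nullSingletonClass_P0 : NullSingletonClass M.P0 := by
  rw [h.P0_eq]
  infer_instance

lemma nullSingletonClass_P1 : NullSingletonClass M.P1 := by
  rw [P1, h.base]
  infer_instance

lemma integral_leInd_P0 {t : ℝ} (ht : t ∈ Set.Icc (0 : ℝ) 1) : ∫ x, leInd t x ∂M.P0 = t := by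
  have : leInd t = (Set.Iic t).indicator 1 := by
    funext x
    simp [leInd, Set.indicator]
  rw [this, integral_indicator_one measurableSet_Iic, h.P0_eq, measureReal_restrict_apply
    measurableSet_Iic]
  have hset : (Set.Iic t ∩ Set.Ioo 0 1 : Set ℝ) =ᵐ[volume] (Set.Ioc 0 t : Set ℝ) := by
    have h1 : ∀ᵐ x : ℝ, x ≠ 1 := by simp [ae_iff]
    filter_upwards [h1] with x hx
    refine propext ⟨fun hm => ⟨hm.2.1, hm.1⟩, fun hm => ⟨hm.2, hm.1, ?_⟩⟩
    exact lt_of_le_of_ne (hm.2.trans ht.2) hx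
  rw [measureReal_congr hset]
  simp [ht.1]

lemma integral_leInd_P1_zero : ∫ x, leInd 0 x ∂M.P1 = 0 := by
  rw [h.integral_P1]
  refine setIntegral_eq_zero_of_forall_eq_zero fun x hx => ?_
  simp [leInd, not_le.2 hx.1]

lemma integral_leInd_P1_one : ∫ x, leInd 1 x ∂M.P1 = 1 := by
  calc ∫ x, leInd 1 x ∂M.P1 = ∫ _, (1 : ℝ) ∂M.P1 := by
        rw [h.integral_P1, h.integral_P1]
        refine setIntegral_congr_fun measurableSet_Ioo fun x hx => ?_
        simp only [leInd, if_pos hx.2.le]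
    _ = 1 := by simp

/-- Among `[0,1]`-valued tests, the threshold test at `s` is optimal for the Lagrangian with
multiplier `f1 s`. -/
lemma integral_P1_sub_le {q : ℝ → ℝ} (hq : Measurable q) (hq01 : ∀ x, q x ∈ Set.Icc (0 : ℝ) 1)
    {s : ℝ} (hs : s ∈ Set.Ioo (0 : ℝ) 1) :
    ∫ x, q x ∂M.P1 - ∫ x, leInd s x ∂M.P1 ≤ M.f1 s * (∫ x, q x ∂M.P0 - s) := by
  have hint {p : ℝ → ℝ} (hp : Measurable p) (hp01 : ∀ x, p x ∈ Set.Icc (0 : ℝ) 1) :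
      IntegrableOn p (Set.Ioo 0 1) ∧ IntegrableOn (fun x => M.f1 x * p x) (Set.Ioo 0 1) :=
    ⟨integrable_of_bounded _ hp fun x => abs_le_one_of_mem_Icc (hp01 x),
      h.integrable_f1.integrableOn.mul_bdd hp.aestronglyMeasurable
        (Eventually.of_forall fun x => abs_le_one_of_mem_Icc (hp01 x))⟩
  obtain ⟨hq0, hq1⟩ := hint hq hq01
  obtain ⟨hi0, hi1⟩ := hint (measurable_leInd s) (leInd_mem s)
  have hneg : ∫ x in Set.Ioo 0 1,
      ((M.f1 x * q x - M.f1 x * leInd s x) - M.f1 s * (q x - leInd s x)) ≤ 0 := by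
    refine setIntegral_nonpos measurableSet_Ioo fun x hx => ?_
    have hqx := hq01 x
    rcases le_or_gt x s with hxs | hxs
    · have := h.f1_anti.antitoneOn hx hs hxs
      simp only [leInd, if_pos hxs]
      nlinarith [hqx.2]
    · have := h.f1_anti.antitoneOn hs hx hxs.le
      simp only [leInd, if_neg (not_le.2 hxs)]
      nlinarith [hqx.1]
  have hd0 : IntegrableOn (fun x => q x - leInd s x) (Set.Ioo 0 1) := hq0.sub hi0
  have hd1 : IntegrableOn (fun x => M.f1 x * q x - M.f1 x * leInd s x) (Set.Ioo 0 1) :=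
    hq1.sub hi1
  rw [integral_sub hd1 (hd0.const_mul _), integral_sub hq1 hi1,
    integral_const_mul, integral_sub hq0 hi0, ← h.integral_P1, ← h.integral_P1, ← h.P0_eq,
    h.integral_leInd_P0 ⟨hs.1.le, hs.2.le⟩] at hneg
  linarith

end UniformNull

variable (M)

/-- The distribution function of the marginal law of an observation. -/
noncomputable def mixCDF (t : ℝ) : ℝ :=
  M.π0 * ∫ x, leInd t x ∂M.P0 + M.π1 * ∫ x, leInd t x ∂M.P1

variable {M}

namespace UniformNull

variable (h : M.UniformNull)
include h

lemma continuous_mixCDF : Continuous M.mixCDF := by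
  have := h.nullSingletonClass_P0
  have := h.nullSingletonClass_P1
  exact ((continuous_integral_leInd M.P0).const_mul _).add
    ((continuous_integral_leInd M.P1).const_mul _)

lemma f_eq {x : ℝ} (hx : x ∈ Set.Ioo (0 : ℝ) 1) : M.f x = M.π0 + M.π1 * M.f1 x := by
  simp [f, h.f0, hx.1, hx.2]

lemma mix_sub_le {q : ℝ → ℝ} (hq : Measurable q) (hq01 : ∀ x, q x ∈ Set.Icc (0 : ℝ) 1)
    {s : ℝ} (hs : s ∈ Set.Ioo (0 : ℝ) 1) :
    M.π0 * ∫ x, q x ∂M.P0 + M.π1 * ∫ x, q x ∂M.P1 - M.mixCDF s ≤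
      M.f s * (∫ x, q x ∂M.P0 - s) := by
  have := mul_le_mul_of_nonneg_left (h.integral_P1_sub_le hq hq01 hs) M.π1_pos.le
  rw [h.f_eq hs, mixCDF, h.integral_leInd_P0 ⟨hs.1.le, hs.2.le⟩]
  linarith

lemma mixCDF_zero : M.mixCDF 0 = 0 := by
  simp [mixCDF, h.integral_leInd_P0, h.integral_leInd_P1_zero]

lemma mixCDF_one : M.mixCDF 1 = 1 := by
  simp [mixCDF, h.integral_leInd_P0, h.integral_leInd_P1_one, π1]

lemma mixCDF_sub_le {s t : ℝ} (hs : s ∈ Set.Ioo (0 : ℝ) 1) (ht : t ∈ Set.Icc (0 : ℝ) 1) :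
    M.mixCDF t - M.mixCDF s ≤ M.f s * (t - s) := by
  have := h.mix_sub_le (measurable_leInd t) (leInd_mem t) hs
  rw [h.integral_leInd_P0 ht] at this
  rwa [mixCDF, h.integral_leInd_P0 ht]

lemma strictAntiOn_f : StrictAntiOn M.f (Set.Ioo 0 1) := fun x hx y hy hxy => by
  rw [h.f_eq hx, h.f_eq hy]
  have := mul_lt_mul_of_pos_left (h.f1_anti hx hy hxy) M.π1_pos
  linarith

end UniformNull

end Model
namespace Model

variable {M : Model ℝ}

/-- The distribution function of the observations crosses the line of slope `π0 / α` at `s`, and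
nowhere else in `(0,1]`. -/
structure IsCrossing (M : Model ℝ) (α s : ℝ) : Prop where
  mem : s ∈ Set.Ioo (0 : ℝ) 1
  eq : M.mixCDF s = M.π0 / α * s
  slope : M.f s < M.π0 / α
  above : ∀ t, 0 < t → t < s → M.π0 / α * t < M.mixCDF t
  below : ∀ t, s < t → t ≤ 1 → M.mixCDF t < M.π0 / α * t

namespace UniformNull

variable (h : M.UniformNull)
include h

lemma pos_of_mem {L : ℝ} (hL : Tendsto M.f (nhdsWithin 0 (Set.Ioi 0)) (nhds L)) {α : ℝ}
    (hα : α ∈ Set.Ioo (M.π0 / L) M.π0) : 0 < α ∧ M.π0 / α < L := by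
  have hL0 : M.π0 ≤ L := by
    refine ge_of_tendsto hL ?_
    filter_upwards [Ioo_mem_nhdsGT one_pos] with x hx
    rw [h.f_eq hx]
    have := mul_nonneg M.π1_pos.le (M.f1_nonneg x)
    linarith
  have hLpos := M.π0_mem.1.trans_le hL0
  have hα0 : 0 < α := (div_pos M.π0_mem.1 hLpos).trans hα.1
  exact ⟨hα0, (div_lt_comm₀ hLpos hα0).1 hα.1⟩

lemma exists_isCrossing {L : ℝ} (hL : Tendsto M.f (nhdsWithin 0 (Set.Ioi 0)) (nhds L)) {α : ℝ}
    (hα : α ∈ Set.Ioo (M.π0 / L) M.π0) : ∃ s, M.IsCrossing α s := by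
  obtain ⟨hα0, hkL⟩ := h.pos_of_mem hL hα
  obtain ⟨s, hs, h1, h2, h3, h4⟩ := exists_crossing h.continuous_mixCDF h.mixCDF_zero
    h.mixCDF_one (fun s hs t ht => h.mixCDF_sub_le hs ht) h.strictAntiOn_f hL hkL
    ((one_lt_div hα0).2 hα.2)
  exact ⟨s, hs, h1, h2, h3, h4⟩

end UniformNull

/-- The rejection probability of a rule for one hypothesis. -/
noncomputable def rejectProb (κ : (Fin 1 → ℝ) → Measure (Fin 1 → Bool)) (x : ℝ) : ℝ :=
  (κ fun _ => x).real {d | d 0 = true}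

lemma integral_reject (κ : (Fin 1 → ℝ) → Measure (Fin 1 → Bool)) (y : Fin 1 → ℝ) :
    ∫ d, (if d 0 then (1 : ℝ) else 0) ∂(κ y) = rejectProb κ (y 0) := by
  have hy : y = fun _ => y 0 := by
    funext i
    rw [Subsingleton.elim i 0]
  rw [rejectProb, ← hy, ← integral_indicator_one (Set.toFinite _).measurableSet]
  refine integral_congr_ae (Eventually.of_forall fun d => ?_)
  simp [Set.indicator]

lemma integral_jointN_one {φ : Bool × ℝ → ℝ} (hφ : Measurable φ) :
    ∫ ω, φ (ω 0) ∂M.jointN 1 = ∫ z, φ z ∂M.joint := by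
  rw [← (measurePreserving_eval (fun _ : Fin 1 => M.joint) 0).map_eq,
    integral_map (measurable_pi_apply 0).aemeasurable hφ.aestronglyMeasurable]
  rfl

section SingleHypothesis

variable {κ : (Fin 1 → ℝ) → Measure (Fin 1 → Bool)} (hκ : IsRule κ)
include hκ

lemma measurable_rejectProb : Measurable (rejectProb κ) :=
  ((Measure.measurable_coe (Set.toFinite {d : Fin 1 → Bool | d 0 = true}).measurableSet).comp
    (hκ.1.comp (measurable_pi_lambda _ fun _ => measurable_id))).ennreal_toReal

lemma rejectProb_mem (x : ℝ) : rejectProb κ x ∈ Set.Icc (0 : ℝ) 1 :=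
  have := hκ.2 fun _ => x
  ⟨measureReal_nonneg, measureReal_le_one⟩

lemma integral_accept (y : Fin 1 → ℝ) :
    ∫ d, (if d 0 then (0 : ℝ) else 1) ∂(κ y) = 1 - rejectProb κ (y 0) := by
  have := hκ.2 y
  have hi : Integrable (fun d : Fin 1 → Bool => if d 0 then (1 : ℝ) else 0) (κ y) :=
    integrable_of_bounded _ (measurable_of_countable _) (C := 1) fun d => by
      split_ifs <;> simp
  rw [← integral_reject κ]
  calc ∫ d, (if d 0 then (0 : ℝ) else 1) ∂(κ y)
      = ∫ d, (1 - if d 0 then (1 : ℝ) else 0) ∂(κ y) := by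
        refine integral_congr_ae (Eventually.of_forall fun d => ?_)
        simp only
        split_ifs <;> simp
    _ = 1 - ∫ d, (if d 0 then (1 : ℝ) else 0) ∂(κ y) := by
        rw [integral_sub (integrable_const _) hi]
        simp

lemma mFDR_one : M.mFDR 1 κ = (M.π0 * ∫ x, rejectProb κ x ∂M.P0) /
    (M.π0 * ∫ x, rejectProb κ x ∂M.P0 + M.π1 * ∫ x, rejectProb κ x ∂M.P1) := by
  have hq := measurable_rejectProb hκ
  have hq1 (x : ℝ) := abs_le_one_of_mem_Icc (rejectProb_mem hκ x)
  have hnull : Measurable fun b : Bool => if b then (0 : ℝ) else 1 := measurable_of_countable _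
  have hφ : Measurable fun z : Bool × ℝ => rejectProb κ z.2 * if z.1 then 0 else 1 :=
    (hq.comp measurable_snd).mul (hnull.comp measurable_fst)
  unfold mFDR nFD nRej
  simp only [Fin.sum_univ_one, integral_mul_const, integral_reject κ]
  rw [integral_jointN_one hφ,
    integral_jointN_one (φ := fun z => rejectProb κ z.2) (hq.comp measurable_snd),
    M.integral_joint hφ (C := 1),
    M.integral_joint (φ := fun z => rejectProb κ z.2) (hq.comp measurable_snd) (C := 1)
      fun z => hq1 z.2]
  · simp
  · rintro ⟨b, x⟩
    cases b <;> simp [hq1]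

lemma mFNR_one : M.mFNR 1 κ = M.π1 * (1 - ∫ x, rejectProb κ x ∂M.P1) /
    (1 - (M.π0 * ∫ x, rejectProb κ x ∂M.P0 + M.π1 * ∫ x, rejectProb κ x ∂M.P1)) := by
  have hq := measurable_rejectProb hκ
  have hqm : Measurable fun z : Bool × ℝ => 1 - rejectProb κ z.2 :=
    (hq.comp measurable_snd).const_sub 1
  have hq1 (x : ℝ) : |1 - rejectProb κ x| ≤ 1 :=
    abs_le_one_of_mem_Icc ⟨by linarith [(rejectProb_mem hκ x).2],
      by linarith [(rejectProb_mem hκ x).1]⟩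
  have hqi (P : Measure ℝ) [IsProbabilityMeasure P] :
      ∫ x, (1 - rejectProb κ x) ∂P = 1 - ∫ x, rejectProb κ x ∂P := by
    rw [integral_sub (integrable_const _)
      (integrable_of_bounded _ hq fun x => abs_le_one_of_mem_Icc (rejectProb_mem hκ x))]
    simp
  have halt : Measurable fun b : Bool => if b then (1 : ℝ) else 0 := measurable_of_countable _
  have hφ : Measurable fun z : Bool × ℝ => (1 - rejectProb κ z.2) * if z.1 then 1 else 0 :=
    hqm.mul (halt.comp measurable_fst)
  unfold mFNR nFN nAcc
  simp only [Fin.sum_univ_one, integral_mul_const, integral_accept hκ]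
  rw [integral_jointN_one hφ,
    integral_jointN_one hqm,
    M.integral_joint hφ (C := 1),
    M.integral_joint hqm (C := 1) fun z => hq1 z.2]
  · simp only [if_true, mul_one, Bool.false_eq_true, if_false, mul_zero, integral_zero, zero_add,
      hqi]
    congr 1
    simp only [π1]
    ring
  · rintro ⟨b, x⟩
    cases b <;> simp [hq1]

end SingleHypothesis

lemma UniformNull.mul_one_sub_le (h : M.UniformNull) {α s : ℝ} (hs : M.IsCrossing α s) :
    M.π0 * (1 - s) ≤ 1 - M.π0 / α * s := by
  have hle : ∫ x, leInd s x ∂M.P1 ≤ 1 := by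
    calc ∫ x, leInd s x ∂M.P1 ≤ ∫ _, (1 : ℝ) ∂M.P1 :=
          integral_mono (integrable_of_bounded _ (measurable_leInd s) fun x =>
            abs_le_one_of_mem_Icc (leInd_mem s x)) (integrable_const _)
            fun x => (leInd_mem s x).2
      _ = 1 := by simp
  rw [← hs.eq, mixCDF, h.integral_leInd_P0 ⟨hs.mem.1.le, hs.mem.2.le⟩]
  have := mul_le_mul_of_nonneg_left hle M.π1_pos.le
  simp only [π1] at this ⊢
  linarith

lemma UniformNull.mFNRstar_eq (h : M.UniformNull) {α s : ℝ} (hα0 : 0 < α)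
    (hs : M.IsCrossing α s) :
    M.mFNRstar α = 1 - M.π0 * (1 - s) / (1 - M.π0 / α * s) := by
  have hπ := M.π0_mem.1
  have hs0 := hs.mem.1
  have hs1 := hs.mem.2
  have hF1 := h.mul_one_sub_le hs
  have hA : 0 < 1 - M.π0 / α * s := lt_of_lt_of_le (by nlinarith) hF1
  have hk : 0 < M.π0 / α := div_pos hπ hα0
  refine IsLeast.csInf_eq ⟨?_, ?_⟩
  · let κ : (Fin 1 → ℝ) → Measure (Fin 1 → Bool) :=
      fun x => Measure.dirac fun i => decide (x i ≤ s)
    have hdec : Measurable fun (x : Fin 1 → ℝ) (i : Fin 1) => decide (x i ≤ s) :=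
      measurable_pi_lambda _ fun i => measurable_to_bool (by
        simpa [Set.preimage] using measurableSet_le (measurable_pi_apply i) measurable_const)
    have hκ : IsRule κ := ⟨Measure.measurable_dirac.comp hdec, fun x => by
      simp only [κ]
      infer_instance⟩
    have hq : rejectProb κ = leInd s := by
      funext x
      by_cases hx : x ≤ s <;> simp [rejectProb, κ, leInd, hx, Measure.real]
    have hFs := hs.eq
    rw [mixCDF, h.integral_leInd_P0 ⟨hs0.le, hs1.le⟩] at hFs
    refine ⟨κ, hκ, ?_, ?_⟩
    · rw [mFDR_one hκ, hq, h.integral_leInd_P0 ⟨hs0.le, hs1.le⟩, hFs]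
      have : M.π0 * s / (M.π0 / α * s) = α := by
        field_simp
      exact this.le
    · rw [mFNR_one hκ, hq, h.integral_leInd_P0 ⟨hs0.le, hs1.le⟩, hFs, eq_div_iff hA.ne', sub_mul,
        div_mul_cancel₀ _ hA.ne']
      simp only [π1] at hFs ⊢
      linarith
  · rintro r ⟨κ, hκ, hfdr, rfl⟩
    have hv0 : 0 ≤ ∫ x, rejectProb κ x ∂M.P0 :=
      integral_nonneg fun x => (rejectProb_mem hκ x).1
    have hw0 : 0 ≤ ∫ x, rejectProb κ x ∂M.P1 :=
      integral_nonneg fun x => (rejectProb_mem hκ x).1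
    have hsup := h.mix_sub_le (measurable_rejectProb hκ) (rejectProb_mem hκ) hs.mem
    have hone := h.mixCDF_sub_le hs.mem (t := 1) (by simp)
    rw [mFDR_one hκ] at hfdr
    rw [mFNR_one hκ]
    rw [h.mixCDF_one, hs.eq] at hone
    rw [hs.eq] at hsup
    have hslope := hs.slope
    generalize ∫ x, rejectProb κ x ∂M.P0 = v at *
    generalize ∫ x, rejectProb κ x ∂M.P1 = w at *
    have hkv : M.π0 / α * v ≤ M.π0 * v + M.π1 * w := by
      have hw1 := mul_nonneg M.π1_pos.le hw0
      have hv1 := mul_nonneg hπ.le hv0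
      rcases (add_nonneg hv1 hw1).eq_or_lt with h0 | h0
      · have : v = 0 := by nlinarith
        rw [this] at h0 ⊢
        linarith
      · rw [div_le_iff₀ h0] at hfdr
        rw [div_mul_eq_mul_div, div_le_iff₀ hα0]
        linarith
    have hR : M.π1 * (1 - w) = 1 - (M.π0 * v + M.π1 * w) - M.π0 * (1 - v) := by
      simp only [π1]
      ring
    rw [hR]
    generalize M.π0 * v + M.π1 * w = R at *
    generalize M.π0 / α = k at *
    have hvs : v ≤ s := by
      by_contra! hlt
      nlinarith
    have hs1' : 0 < 1 - s := by linarith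
    have hR1 : (1 - k * s) * (1 - v) ≤ (1 - R) * (1 - s) := by
      nlinarith [mul_nonneg (sub_nonneg.2 hone) (sub_nonneg.2 hvs)]
    have hRpos : 0 < 1 - R := by
      have : 0 < (1 - k * s) * (1 - v) := mul_pos hA (by linarith)
      exact pos_of_mul_pos_left (this.trans_le hR1) hs1'.le
    rw [sub_div, div_self hRpos.ne']
    refine sub_le_sub_left ?_ _
    rw [div_le_div_iff₀ hRpos hA]
    nlinarith

end Model
lemma cast_countLE {n : ℕ} (x : Fin n → ℝ) (t : ℝ) : (countLE x t : ℝ) = ∑ i, leInd t (x i) := by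
  simp [countLE, leInd, Finset.sum_boole]

lemma leInd_mono {s t : ℝ} (hst : s ≤ t) (x : ℝ) : leInd s x ≤ leInd t x := by
  unfold leInd
  split_ifs with h1 h2
  · rfl
  · exact absurd (h1.trans hst) h2
  · exact zero_le_one
  · rfl

lemma nAcc_eq {n : ℕ} (d : Fin n → Bool) : nAcc d = n - nRej d := by
  have : (n : ℝ) = ∑ _i : Fin n, (1 : ℝ) := by simp
  rw [this, nAcc, nRej, ← Finset.sum_sub_distrib]
  exact Finset.sum_congr rfl fun i _ => by cases d i <;> simp

lemma nFN_eq {n : ℕ} (θ d : Fin n → Bool) :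
    nFN θ d = (∑ i, if θ i then (1 : ℝ) else 0) - nRej d + nFD θ d := by
  rw [nFN, nFD, nRej, ← Finset.sum_sub_distrib, ← Finset.sum_add_distrib]
  exact Finset.sum_congr rfl fun i _ => by cases d i <;> cases θ i <;> simp

lemma abs_sum_le_of_abs_le_one {n : ℕ} {a : Fin n → ℝ} (ha : ∀ i, |a i| ≤ 1) :
    |∑ i, a i| ≤ n := by
  refine (Finset.abs_sum_le_sum_abs _ _).trans ?_
  simpa using Finset.sum_le_sum fun i (_ : i ∈ Finset.univ) => ha i

lemma abs_nRej_le {n : ℕ} (d : Fin n → Bool) : |nRej d| ≤ n :=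
  abs_sum_le_of_abs_le_one fun i => by cases d i <;> simp

lemma abs_nAcc_le {n : ℕ} (d : Fin n → Bool) : |nAcc d| ≤ n :=
  abs_sum_le_of_abs_le_one fun i => by cases d i <;> simp

lemma abs_nFD_le {n : ℕ} (θ d : Fin n → Bool) : |nFD θ d| ≤ n :=
  abs_sum_le_of_abs_le_one fun i => by cases d i <;> cases θ i <;> simp

lemma abs_nFN_le {n : ℕ} (θ d : Fin n → Bool) : |nFN θ d| ≤ n :=
  abs_sum_le_of_abs_le_one fun i => by cases d i <;> cases θ i <;> simp

lemma tendsto_div_max_one {a b : ℕ → ℝ} {l m : ℝ}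
    (ha : Tendsto (fun n : ℕ => a n / n) atTop (nhds l))
    (hb : Tendsto (fun n : ℕ => b n / n) atTop (nhds m)) (hm : 0 < m) :
    Tendsto (fun n => a n / max 1 (b n)) atTop (nhds (l / m)) := by
  have h1 := (tendsto_one_div_atTop_nhds_zero_nat (𝕜 := ℝ)).max hb
  rw [max_eq_right hm.le] at h1
  refine (ha.div h1 hm.ne').congr' ?_
  filter_upwards [eventually_gt_atTop 0] with n hn
  have hn' : (0 : ℝ) < n := by exact_mod_cast hn
  simp only [Pi.div_apply]
  rw [max_div_div_right hn'.le, div_div_div_cancel_right₀ hn'.ne']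

namespace Model

variable {M : Model ℝ} {α s : ℝ}

lemma iStarBH_div {n : ℕ} (hα : 0 < α) (hn : 0 < n) (x : Fin n → ℝ) :
    (M.iStarBH α n x : ℝ) / n = M.π0 / α * M.bhThreshold α x := by
  have hπ := M.π0_mem.1
  have hn' : (0 : ℝ) < n := by exact_mod_cast hn
  unfold bhThreshold
  field_simp

lemma bhThreshold_mem (hα : 0 < α) {n : ℕ} (x : Fin n → ℝ) :
    M.bhThreshold α x ∈ Set.Icc 0 (α / M.π0) := by
  have hπ := M.π0_mem.1
  refine ⟨by unfold bhThreshold; positivity, ?_⟩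
  rcases Nat.eq_zero_or_pos n with rfl | hn
  · simp only [bhThreshold, Nat.cast_zero, zero_mul, div_zero]
    positivity
  · have hn' : (0 : ℝ) < n := by exact_mod_cast hn
    have h1 : (M.iStarBH α n x : ℝ) ≤ n := by exact_mod_cast (M.iStarBH_mem α x).1
    unfold bhThreshold
    rw [div_le_div_iff₀ (by positivity) hπ]
    have := mul_le_mul_of_nonneg_right h1 (mul_pos hα hπ).le
    linarith

/-- If the empirical distribution functions converge at rational points, then the
Benjamini–Hochberg threshold converges to the crossing point. -/
lemma IsCrossing.tendsto_bhThreshold (hs : M.IsCrossing α s) (hF : Continuous M.mixCDF)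
    (hα0 : 0 < α) (hα1 : α < M.π0) {x : (n : ℕ) → Fin n → ℝ}
    (hx : ∀ q : ℚ, Tendsto (fun n => (countLE (x n) q : ℝ) / n) atTop (nhds (M.mixCDF q))) :
    Tendsto (fun n => M.bhThreshold α (x n)) atTop (nhds s) := by
  have hπ := M.π0_mem.1
  have hk : 0 < M.π0 / α := div_pos hπ hα0
  refine isCompact_Icc.tendsto_nhds_of_unique_mapClusterPt
    (Eventually.of_forall fun n => bhThreshold_mem hα0 (x n)) fun y hy hclus => ?_
  have hy1 : y ≤ 1 := hy.2.trans ((div_le_one hπ).2 hα1.le)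
  refine le_antisymm ?_ ?_
  · by_contra! hlt
    have hFy := hs.below y hlt hy1
    obtain ⟨m, hm1, hm2⟩ := exists_between hFy
    have hnear : ∀ᶠ t in nhds y, M.mixCDF t < m := hF.continuousAt.eventually_lt_const hm1
    obtain ⟨u, hyu, hu⟩ := exists_Ico_subset_of_mem_nhds hnear ⟨y + 1, by linarith⟩
    obtain ⟨q, hq1, hq2⟩ := exists_rat_btwn hyu
    have hFq : M.mixCDF q < m := hu ⟨hq1.le, hq2⟩
    have hev := (hx q).eventually (gt_mem_nhds hFq)
    have hfreq := hclus.frequently (Ioo_mem_nhds ((div_lt_iff₀' hk).2 hm2) hq1)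
    obtain ⟨n, ⟨hτ1, hτ2⟩, hn1, hn2⟩ :=
      (hfreq.and_eventually (hev.and (eventually_gt_atTop 0))).exists
    have h1 := iStarBH_div (M := M) hα0 hn2 (x n)
    rw [← M.countLE_bhThreshold (x n) hα0.le] at h1
    have h2 : (countLE (x n) (M.bhThreshold α (x n)) : ℝ) / n ≤ countLE (x n) q / n := by
      gcongr
      exact countLE_mono _ hτ2.le
    rw [div_lt_iff₀' hk] at hτ1
    linarith
  · by_contra! hlt
    obtain ⟨q, hq1, hq2⟩ := exists_rat_btwn hlt
    have hFq := hs.above q (hy.1.trans_lt hq1) hq2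
    have hev := (hx q).eventually (lt_mem_nhds hFq)
    have hfreq := hclus.frequently (Iio_mem_nhds hq1)
    obtain ⟨n, hτ, hn1, hn2⟩ :=
      (hfreq.and_eventually (hev.and (eventually_gt_atTop 0))).exists
    have hn' : (0 : ℝ) < n := by exact_mod_cast hn2
    refine (not_le.2 hτ) (M.le_bhThreshold (x n) hα0 hn2 ?_)
    rw [lt_div_iff₀ hn', div_mul_eq_mul_div, div_mul_eq_mul_div, div_lt_iff₀ hα0] at hn1
    linarith

/-- The labels of a sample. -/
def labels {n : ℕ} (z : Fin n → Bool × ℝ) : Fin n → Bool := fun i => (z i).1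

/-- The observations of a sample. -/
def observations {n : ℕ} (z : Fin n → Bool × ℝ) : Fin n → ℝ := fun i => (z i).2

lemma measurable_bh_statistic (M : Model ℝ) (hα : 0 ≤ α) {n : ℕ}
    (g : (Fin n → Bool) → (Fin n → Bool) → ℝ) :
    Measurable fun z : Fin n → Bool × ℝ => g (labels z) (M.bhDecision α (observations z)) := by
  have h1 : Measurable (labels : (Fin n → Bool × ℝ) → Fin n → Bool) := by
    unfold labels
    fun_prop
  have h2 : Measurable (observations : (Fin n → Bool × ℝ) → Fin n → ℝ) := by
    unfold observations
    fun_prop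
  have hg : Measurable fun p : (Fin n → Bool) × (Fin n → Bool) => g p.1 p.2 :=
    measurable_of_countable _
  exact hg.comp (h1.prodMk ((M.measurable_bhDecision hα).comp h2))

/-- Almost surely, the counts of rejections, false discoveries, acceptances and false
non-discoveries of the Benjamini–Hochberg rule are asymptotically linear. -/
lemma UniformNull.ae_tendsto_counts (h : M.UniformNull) (hs : M.IsCrossing α s) (hα0 : 0 < α)
    (hα1 : α < M.π0) :
    ∀ᵐ ω ∂M.seqLaw,
      Tendsto (fun n : ℕ => nRej (M.bhDecision α (observations (initial n ω))) / n) atTop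
        (nhds (M.π0 / α * s)) ∧
      Tendsto (fun n : ℕ => nFD (labels (initial n ω))
        (M.bhDecision α (observations (initial n ω))) / n) atTop (nhds (M.π0 * s)) ∧
      Tendsto (fun n : ℕ => nAcc (M.bhDecision α (observations (initial n ω))) / n) atTop
        (nhds (1 - M.π0 / α * s)) ∧
      Tendsto (fun n : ℕ => nFN (labels (initial n ω))
        (M.bhDecision α (observations (initial n ω))) / n) atTop
        (nhds (1 - M.π0 / α * s - M.π0 * (1 - s))) := by
  have hπ := M.π0_mem.1
  have hnull : Measurable fun b : Bool => if b then (0 : ℝ) else 1 := measurable_of_countable _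
  have halt : Measurable fun b : Bool => if b then (1 : ℝ) else 0 := measurable_of_countable _
  have hle (t : ℝ) : Measurable fun z : Bool × ℝ => leInd t z.2 :=
    (measurable_leInd t).comp measurable_snd
  have hleb (t : ℝ) (z : Bool × ℝ) : |leInd t z.2| ≤ 1 := abs_le_one_of_mem_Icc (leInd_mem t _)
  have hnl (t : ℝ) : Measurable fun z : Bool × ℝ => leInd t z.2 * if z.1 then 0 else 1 :=
    (hle t).mul (hnull.comp measurable_fst)
  have hnlb (t : ℝ) (z : Bool × ℝ) : |leInd t z.2 * if z.1 then 0 else 1| ≤ 1 := by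
    obtain ⟨b, x⟩ := z
    cases b <;> simp [abs_le_one_of_mem_Icc (leInd_mem t x)]
  have h1 : ∀ᵐ ω ∂M.seqLaw, ∀ q : ℚ, Tendsto
      (fun n => (countLE (observations (initial n ω)) q : ℝ) / n) atTop (nhds (M.mixCDF q)) := by
    refine ae_all_iff.2 fun q => ?_
    have := M.ae_tendsto_average (hle q) (hleb q)
    rw [M.integral_joint (hle q) (hleb q)] at this
    simp only [cast_countLE]
    exact this
  have h2 : ∀ᵐ ω ∂M.seqLaw, ∀ q : ℚ, Tendsto
      (fun n : ℕ => (∑ i, leInd q (initial n ω i).2 * if (initial n ω i).1 then 0 else 1) / n)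
      atTop (nhds (M.π0 * ∫ x, leInd q x ∂M.P0)) := by
    refine ae_all_iff.2 fun q => ?_
    have := M.ae_tendsto_average (hnl q) (hnlb q)
    rw [M.integral_joint (hnl q) (hnlb q)] at this
    simpa using this
  have h3 : ∀ᵐ ω ∂M.seqLaw, Tendsto
      (fun n : ℕ => (∑ i, if labels (initial n ω) i then (1 : ℝ) else 0) / n)
      atTop (nhds M.π1) := by
    have hm : Measurable fun z : Bool × ℝ => if z.1 then (1 : ℝ) else 0 :=
      halt.comp measurable_fst
    have hb (z : Bool × ℝ) : |if z.1 then (1 : ℝ) else 0| ≤ 1 := by split_ifs <;> simp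
    have := M.ae_tendsto_average hm hb
    rw [M.integral_joint hm hb] at this
    simp only [Bool.false_eq_true, if_false, if_true, integral_const, probReal_univ, one_smul,
      smul_zero, mul_zero, mul_one, zero_add] at this
    exact this
  filter_upwards [h1, h2, h3] with ω hω1 hω2 hω3
  have hτ := hs.tendsto_bhThreshold h.continuous_mixCDF hα0 hα1 hω1
  have hrej : Tendsto (fun n : ℕ => nRej (M.bhDecision α (observations (initial n ω))) / n) atTop
      (nhds (M.π0 / α * s)) := by
    refine (hτ.const_mul (M.π0 / α)).congr' ?_
    filter_upwards [eventually_gt_atTop 0] with n hn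
    rw [← iStarBH_div hα0 hn, ← M.countLE_bhThreshold _ hα0.le, cast_countLE,
      M.bhDecision_eq _ hα0.le]
    simp [nRej, leInd]
  have hfd : Tendsto (fun n : ℕ => nFD (labels (initial n ω))
      (M.bhDecision α (observations (initial n ω))) / n) atTop (nhds (M.π0 * s)) := by
    have hfd_eq (n : ℕ) : nFD (labels (initial n ω))
        (M.bhDecision α (observations (initial n ω))) =
        ∑ i, leInd (M.bhThreshold α (observations (initial n ω))) (initial n ω i).2 *
          if (initial n ω i).1 then 0 else 1 := by
      rw [M.bhDecision_eq _ hα0.le, nFD]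
      refine Finset.sum_congr rfl fun i _ => ?_
      by_cases hi : observations (initial n ω) i ≤ M.bhThreshold α (observations (initial n ω))
      · rw [leInd, if_pos (decide_eq_true hi), if_pos (show (initial n ω i).2 ≤ _ from hi)]
        rfl
      · rw [leInd, if_neg fun hd => hi (of_decide_eq_true hd),
          if_neg (show ¬(initial n ω i).2 ≤ _ from hi)]
        rfl
    have hmono {t u : ℝ} (htu : t ≤ u) (n : ℕ) :
        (∑ i, leInd t (initial n ω i).2 * if (initial n ω i).1 then 0 else 1) / (n : ℝ) ≤
        (∑ i, leInd u (initial n ω i).2 * if (initial n ω i).1 then 0 else 1) / (n : ℝ) := by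
      gcongr with i
      exact leInd_mono htu _
    simp only [hfd_eq]
    refine tendsto_order.2 ⟨fun a ha => ?_, fun a ha => ?_⟩
    · have : max (a / M.π0) 0 < s := max_lt ((div_lt_iff₀' hπ).2 ha) hs.mem.1
      obtain ⟨q, hq1, hq2⟩ := exists_rat_btwn this
      have hlim := hω2 q
      rw [h.integral_leInd_P0 ⟨((le_max_right _ _).trans_lt hq1).le,
        (hq2.trans hs.mem.2).le⟩] at hlim
      have haq : a < M.π0 * q := (div_lt_iff₀' hπ).1 ((le_max_left _ _).trans_lt hq1)
      filter_upwards [hlim.eventually (lt_mem_nhds haq), hτ.eventually (lt_mem_nhds hq2)]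
        with n hn1 hn2
      exact hn1.trans_le (hmono hn2.le n)
    · have : s < min (a / M.π0) 1 := lt_min ((lt_div_iff₀' hπ).2 ha) hs.mem.2
      obtain ⟨q, hq1, hq2⟩ := exists_rat_btwn this
      have hlim := hω2 q
      rw [h.integral_leInd_P0 ⟨(hs.mem.1.trans hq1).le,
        (hq2.trans_le (min_le_right _ _)).le⟩] at hlim
      have haq : M.π0 * q < a := (lt_div_iff₀' hπ).1 (hq2.trans_le (min_le_left _ _))
      filter_upwards [hlim.eventually (gt_mem_nhds haq), hτ.eventually (gt_mem_nhds hq1)]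
        with n hn1 hn2
      exact (hmono hn2.le n).trans_lt hn1
  refine ⟨hrej, hfd, ?_, ?_⟩
  · refine (hrej.const_sub 1).congr' ?_
    filter_upwards [eventually_gt_atTop 0] with n hn
    have hn' : (n : ℝ) ≠ 0 := by exact_mod_cast hn.ne'
    rw [nAcc_eq, sub_div, div_self hn']
  · have hlim : M.π1 - M.π0 / α * s + M.π0 * s = 1 - M.π0 / α * s - M.π0 * (1 - s) := by
      simp only [π1]
      ring
    rw [← hlim]
    refine ((hω3.sub hrej).add hfd).congr fun n => ?_
    rw [nFN_eq, add_div, sub_div]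

lemma integral_BH (M : Model ℝ) (α : ℝ) (n : ℕ) (g : (Fin n → Bool) → (Fin n → Bool) → ℝ) :
    ∫ ω, ∫ d, g (fun i => (ω i).1) d ∂(M.BH α n fun i => (ω i).2) ∂(M.jointN n) =
      ∫ z, g (labels z) (M.bhDecision α (observations z)) ∂(M.jointN n) := by
  refine integral_congr_ae (Eventually.of_forall fun ω => ?_)
  exact integral_dirac _ _

lemma prob_BH (M : Model ℝ) (hα : 0 ≤ α) (n : ℕ) (g : (Fin n → Bool) → (Fin n → Bool) → ℝ)
    (ε l : ℝ) :
    M.prob n (M.BH α n) (fun θ => {d | ε < |g θ d - l|}) =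
      (M.jointN n {z | ε < |g (labels z) (M.bhDecision α (observations z)) - l|}).toReal := by
  have hS : MeasurableSet {z : Fin n → Bool × ℝ |
      ε < |g (labels z) (M.bhDecision α (observations z)) - l|} :=
    measurableSet_lt measurable_const ((M.measurable_bh_statistic hα g).sub_const l).abs
  rw [prob, ← lintegral_indicator_one hS]
  congr 1
  refine lintegral_congr fun ω => ?_
  exact Measure.dirac_apply _ _

end Model
/-- **Asymptotics of the oracle Benjamini–Hochberg procedure** (Proposition 1). In the uniform
null model on `(0,1)` with `f1` strictly decreasing on `(0,1)` and `W1` continuous, for any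
`α ∈ (π0/f(0+), π0)`: `mFDR(δ^n_BH(α)) → α`, `mFNR(δ^n_BH(α)) → mFNR*(α)`,
`FDP(δ^n_BH(α)) → α` in probability and `FNP(δ^n_BH(α)) → mFNR*(α)` in probability. -/
theorem BH_asymptotics (M : Model ℝ) (hbase : M.base = MeasureTheory.volume)
    (hf0 : M.f0 = fun x => if 0 < x ∧ x < 1 then (1 : ℝ) else 0)
    (hf1supp : ∀ x : ℝ, ¬(0 < x ∧ x < 1) → M.f1 x = 0)
    (hf1anti : StrictAntiOn M.f1 (Set.Ioo 0 1))
    (hWcont : ∀ t : ℝ, M.νW {t} = 0)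
    (L : ℝ) (hL : Filter.Tendsto M.f (nhdsWithin 0 (Set.Ioi 0)) (nhds L))
    (α : ℝ) (hα : α ∈ Set.Ioo (M.π0 / L) M.π0) :
    Filter.Tendsto (fun n => M.mFDR n (M.BH α n)) Filter.atTop (nhds α) ∧
    Filter.Tendsto (fun n => M.mFNR n (M.BH α n)) Filter.atTop (nhds (M.mFNRstar α)) ∧
    (∀ ε > (0 : ℝ),
      Filter.Tendsto (fun n => M.prob n (M.BH α n) fun θ => {d | ε < |FDP θ d - α|})
        Filter.atTop (nhds 0)) ∧
    (∀ ε > (0 : ℝ),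
      Filter.Tendsto
        (fun n => M.prob n (M.BH α n) fun θ => {d | ε < |FNP θ d - M.mFNRstar α|})
        Filter.atTop (nhds 0)) := by
  have h : M.UniformNull := ⟨hbase, hf0, hf1supp, hf1anti⟩
  have hα0 := (h.pos_of_mem hL hα).1
  have hπ := M.π0_mem.1
  obtain ⟨s, hs⟩ := h.exists_isCrossing hL hα
  have hcounts := h.ae_tendsto_counts hs hα0 hα.2
  have hR : 0 < M.π0 / α * s := mul_pos (div_pos hπ hα0) hs.mem.1
  have hA : 0 < 1 - M.π0 / α * s :=
    (mul_pos hπ (sub_pos.2 hs.mem.2)).trans_le (h.mul_one_sub_le hs)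
  have hfdr : M.π0 * s / (M.π0 / α * s) = α := by
    have := hs.mem.1
    field_simp
  have hfnr : (1 - M.π0 / α * s - M.π0 * (1 - s)) / (1 - M.π0 / α * s) = M.mFNRstar α := by
    rw [h.mFNRstar_eq hα0 hs, sub_div, div_self hA.ne']
  have hratio {a b : ℕ → ℝ} {l m : ℝ} (ha : Tendsto (fun n : ℕ => a n / n) atTop (nhds l))
      (hb : Tendsto (fun n : ℕ => b n / n) atTop (nhds m)) (hm : 0 < m) :
      Tendsto (fun n => a n / b n) atTop (nhds (l / m)) := by
    refine (ha.div hb hm.ne').congr' ?_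
    filter_upwards [eventually_gt_atTop 0] with n hn
    have hn' : (n : ℝ) ≠ 0 := by exact_mod_cast hn.ne'
    simp only [Pi.div_apply]
    rw [div_div_div_cancel_right₀ hn']
  refine ⟨?_, ?_, fun ε hε => ?_, fun ε hε => ?_⟩
  · have key := hratio
      (M.tendsto_integral_jointN (fun n => M.measurable_bh_statistic hα0.le nFD)
        (fun n z => abs_nFD_le _ _) (hcounts.mono fun ω hω => hω.2.1))
      (M.tendsto_integral_jointN (fun n => M.measurable_bh_statistic hα0.le fun _ => nRej)
        (fun n z => abs_nRej_le _) (hcounts.mono fun ω hω => hω.1)) hR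
    rw [hfdr] at key
    refine key.congr fun n => ?_
    rw [Model.mFDR, M.integral_BH α n nFD, M.integral_BH α n fun _ => nRej]
  · have key := hratio
      (M.tendsto_integral_jointN (fun n => M.measurable_bh_statistic hα0.le nFN)
        (fun n z => abs_nFN_le _ _) (hcounts.mono fun ω hω => hω.2.2.2))
      (M.tendsto_integral_jointN (fun n => M.measurable_bh_statistic hα0.le fun _ => nAcc)
        (fun n z => abs_nAcc_le _) (hcounts.mono fun ω hω => hω.2.2.1)) hA
    rw [hfnr] at key
    refine key.congr fun n => ?_
    rw [Model.mFNR, M.integral_BH α n nFN, M.integral_BH α n fun _ => nAcc]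
  · simp only [M.prob_BH hα0.le _ FDP]
    refine M.tendsto_jointN_deviation (fun n => M.measurable_bh_statistic hα0.le FDP)
      (hcounts.mono fun ω hω => ?_) hε
    have := tendsto_div_max_one hω.2.1 hω.1 hR
    rwa [hfdr] at this
  · simp only [M.prob_BH hα0.le _ FNP]
    refine M.tendsto_jointN_deviation (fun n => M.measurable_bh_statistic hα0.le FNP)
      (hcounts.mono fun ω hω => ?_) hε
    have := tendsto_div_max_one hω.2.2.2 hω.2.2.1 hA
    rwa [hfnr] at this

end TwoGroup
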